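/- Assume the sequence R_1, …, R_m is disjoint-superset and d_i ≥ 1 for every i. Then for every i with 1 ≤ i ≤ m and every coin c: if c ∉ R_i then Pr_i(c) = Pr_{i−1}(c), and if c ∈ R_i then Pr_i(c) = Pr_{i−1}(c) + (1 − Pr_{i−1}(c)) / d_i. -/

import Mathlib

open scoped Classical

/-- The spent coin permutations for the first `k` ring signatures of the
sequence `R` (rings are indexed from `1`): injective functions `σ : Fin k → C`
with `σ(j) ∈ R_j` for each `j ∈ {1, …, k}` (position `j` of `σ` is `j - 1`). -/
noncomputable def perms {C : Type*} [Fintype C] [DecidableEq C]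
    (R : ℕ → Finset C) (k : ℕ) : Finset (Fin k → C) :=
  Finset.univ.filter fun σ => Function.Injective σ ∧ ∀ j : Fin k, σ j ∈ R (j.1 + 1)

/-- `N_k`, the number of spent coin permutations for the first `k` ring signatures. -/
noncomputable def numPerms {C : Type*} [Fintype C] [DecidableEq C]
    (R : ℕ → Finset C) (k : ℕ) : ℕ :=
  (perms R k).card

/-- `Pr_k(c, r_j)`: the fraction of spent coin permutations `σ` for the first `k`
ring signatures with `σ(j) = c`. -/
noncomputable def prSpentIn {C : Type*} [Fintype C] [DecidableEq C]
    (R : ℕ → Finset C) (k j : ℕ) (c : C) : ℝ :=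
  (((perms R k).filter fun σ => ∃ h : j - 1 < k, σ ⟨j - 1, h⟩ = c).card : ℝ) /
    (numPerms R k : ℝ)

/-- `Pr_k(c)`: the fraction of spent coin permutations `σ` for the first `k`
ring signatures having `c` in their image. -/
noncomputable def prSpent {C : Type*} [Fintype C] [DecidableEq C]
    (R : ℕ → Finset C) (k : ℕ) (c : C) : ℝ :=
  (((perms R k).filter fun σ => ∃ j, σ j = c).card : ℝ) / (numPerms R k : ℝ)

/-- `Pr_k(r_j | c) = Pr_k(c, r_j) / Pr_k(c)`. -/
noncomputable def prCond {C : Type*} [Fintype C] [DecidableEq C]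
    (R : ℕ → Finset C) (k j : ℕ) (c : C) : ℝ :=
  prSpentIn R k j c / prSpent R k c

/-- The first `m` ring signatures of `R` are disjoint-superset: for all
`1 ≤ j < i ≤ m`, either `R_i ∩ R_j = ∅` or `R_j ⊆ R_i`. -/
def DisjointSuperset {C : Type*} [Fintype C] [DecidableEq C]
    (R : ℕ → Finset C) (m : ℕ) : Prop :=
  ∀ i j, 1 ≤ j → j < i → i ≤ m → Disjoint (R i) (R j) ∨ R j ⊆ R i

/-- `ns_i`: the number of indices `j < i` with `R_j ⊆ R_i`. -/
noncomputable def nsub {C : Type*} [Fintype C] [DecidableEq C]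
    (R : ℕ → Finset C) (i : ℕ) : ℕ :=
  ((Finset.Ico 1 i).filter fun j => R j ⊆ R i).card

/-- The degree `d_i = |R_i| - ns_i`. -/
noncomputable def deg {C : Type*} [Fintype C] [DecidableEq C]
    (R : ℕ → Finset C) (i : ℕ) : ℕ :=
  (R i).card - nsub R i

theorem mem_perms {C : Type*} [Fintype C] [DecidableEq C] {R : ℕ → Finset C} {k : ℕ}
    {σ : Fin k → C} :
    σ ∈ perms R k ↔ Function.Injective σ ∧ ∀ j : Fin k, σ j ∈ R (j.1 + 1) := by
  simp [perms]

theorem snoc_mem_perms_iff {C : Type*} [Fintype C] [DecidableEq C] {R : ℕ → Finset C} {n : ℕ}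
    {τ : Fin n → C} {x : C} :
    (Fin.snoc τ x : Fin (n + 1) → C) ∈ perms R (n + 1) ↔
      τ ∈ perms R n ∧ x ∈ R (n + 1) \ Finset.univ.image τ := by
  simp only [mem_perms, Fin.snoc_injective_iff, Fin.forall_fin_succ', Fin.snoc_castSucc,
    Fin.snoc_last, Finset.mem_sdiff, Finset.mem_image, Finset.mem_univ, true_and, Set.mem_range,
    Fin.val_castSucc, Fin.val_last]
  tauto

/-- Counting permutations by the coin chosen for the last ring signature. -/
theorem card_filter_perms_succ {C : Type*} [Fintype C] [DecidableEq C] (R : ℕ → Finset C) (n : ℕ)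
    (Q : (Fin (n + 1) → C) → Prop) :
    ((perms R (n + 1)).filter Q).card =
      ∑ τ ∈ perms R n,
        ((R (n + 1) \ Finset.univ.image τ).filter fun x => Q (Fin.snoc τ x)).card := by
  rw [← Finset.card_sigma]
  refine Finset.card_nbij' (fun σ => ⟨Fin.init σ, σ (Fin.last n)⟩)
    (fun p => Fin.snoc p.1 p.2) ?_ ?_ ?_ ?_
  · intro σ hσ
    have hσ' := Finset.mem_filter.1 hσ
    rw [← Fin.snoc_init_self σ, snoc_mem_perms_iff] at hσ'
    exact Finset.mem_sigma.2 ⟨hσ'.1.1, Finset.mem_filter.2 ⟨hσ'.1.2, hσ'.2⟩⟩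
  · rintro ⟨τ, x⟩ hp
    obtain ⟨hτ, hx⟩ := Finset.mem_sigma.1 hp
    obtain ⟨hx, hQ⟩ := Finset.mem_filter.1 hx
    exact Finset.mem_filter.2 ⟨snoc_mem_perms_iff.2 ⟨hτ, hx⟩, hQ⟩
  · intro σ _
    exact Fin.snoc_init_self σ
  · rintro ⟨τ, x⟩ _
    simp

theorem card_sdiff_image_of_mem_perms {C : Type*} [Fintype C] [DecidableEq C] {R : ℕ → Finset C}
    {m n : ℕ} (hds : DisjointSuperset R m)
    (hn : n + 1 ≤ m) {τ : Fin n → C} (hτ : τ ∈ perms R n) :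
    (R (n + 1) \ Finset.univ.image τ).card = deg R (n + 1) := by
  obtain ⟨hinj, hmem⟩ := mem_perms.1 hτ
  have himage : Finset.univ.image τ ∩ R (n + 1) =
      (Finset.univ.filter fun j : Fin n => R (j.1 + 1) ⊆ R (n + 1)).image τ := by
    ext x
    simp only [Finset.mem_inter, Finset.mem_image, Finset.mem_univ, true_and, Finset.mem_filter]
    constructor
    · rintro ⟨⟨j, rfl⟩, hx⟩
      refine ⟨j, ?_, rfl⟩
      refine (hds (n + 1) (j.1 + 1) (by omega) (by omega) hn).resolve_left fun h => ?_
      exact Finset.disjoint_left.1 h hx (hmem j)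
    · rintro ⟨j, hj, rfl⟩
      exact ⟨⟨j, rfl⟩, hj (hmem j)⟩
  rw [Finset.card_sdiff, himage, Finset.card_image_of_injective _ hinj, deg, nsub]
  congr 1
  refine Finset.card_nbij (fun j => j.1 + 1) ?_ ?_ ?_
  · intro j hj
    have hj' := (Finset.mem_filter.1 hj).2
    exact Finset.mem_filter.2 ⟨Finset.mem_Ico.2 ⟨Nat.succ_pos _, Nat.succ_lt_succ j.2⟩, hj'⟩
  · intro a _ b _ h
    exact Fin.ext (Nat.succ_injective h)
  · intro j hj
    obtain ⟨hj, hsub⟩ := Finset.mem_filter.1 hj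
    obtain ⟨h1, h2⟩ := Finset.mem_Ico.1 hj
    obtain ⟨l, rfl⟩ := Nat.exists_eq_add_of_le' h1
    exact ⟨⟨l, by omega⟩, Finset.mem_coe.2 (Finset.mem_filter.2 ⟨Finset.mem_univ _, hsub⟩), rfl⟩

theorem numPerms_succ {C : Type*} [Fintype C] [DecidableEq C] {R : ℕ → Finset C}
    {m n : ℕ} (hds : DisjointSuperset R m)
    (hn : n + 1 ≤ m) : numPerms R (n + 1) = numPerms R n * deg R (n + 1) := by
  have h := card_filter_perms_succ R n fun _ => True
  simp only [Finset.filter_true] at h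
  rw [numPerms, h, Finset.sum_congr rfl fun τ hτ => card_sdiff_image_of_mem_perms hds hn hτ,
    Finset.sum_const, smul_eq_mul, numPerms]

theorem numPerms_pos {C : Type*} [Fintype C] [DecidableEq C] {R : ℕ → Finset C} {m : ℕ}
    (hds : DisjointSuperset R m)
    (hdeg : ∀ i, 1 ≤ i → i ≤ m → 1 ≤ deg R i) :
    ∀ n, n ≤ m → 0 < numPerms R n
  | 0, _ => Finset.card_pos.2 ⟨Fin.elim0, mem_perms.2 ⟨fun a => a.elim0, fun a => a.elim0⟩⟩
  | n + 1, hn => by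
    rw [numPerms_succ hds hn]
    exact Nat.mul_pos (numPerms_pos hds hdeg n (by omega)) (hdeg _ (by omega) hn)

theorem card_filter_snoc {C : Type*} [DecidableEq C] {n : ℕ}
    (τ : Fin n → C) (s : Finset C) (c : C) :
    ((s \ Finset.univ.image τ).filter
      fun x => ∃ j, (Fin.snoc τ x : Fin (n + 1) → C) j = c).card =
      if ∃ j, τ j = c then (s \ Finset.univ.image τ).card else if c ∈ s then 1 else 0 := by
  simp only [Fin.exists_fin_succ', Fin.snoc_castSucc, Fin.snoc_last]
  split_ifs with h hc
  · simp [h]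
  · rw [Finset.card_eq_one]
    refine ⟨c, ?_⟩
    ext x
    simp only [h, false_or, Finset.mem_filter, Finset.mem_sdiff, Finset.mem_image,
      Finset.mem_univ, true_and, Finset.mem_singleton]
    exact ⟨fun hx => hx.2, by rintro rfl; exact ⟨⟨hc, h⟩, rfl⟩⟩
  · rw [Finset.card_eq_zero, Finset.filter_eq_empty_iff]
    rintro x hx (hj | rfl)
    · exact h hj
    · exact hc (Finset.mem_sdiff.1 hx).1

theorem card_filter_perms_succ_exists {C : Type*} [Fintype C] [DecidableEq C] {R : ℕ → Finset C}
    {m n : ℕ} (hds : DisjointSuperset R m)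
    (hn : n + 1 ≤ m) (c : C) :
    ((perms R (n + 1)).filter fun σ => ∃ j, σ j = c).card =
      ((perms R n).filter fun τ => ∃ j, τ j = c).card * deg R (n + 1) +
      ((perms R n).filter fun τ => ¬ ∃ j, τ j = c).card * if c ∈ R (n + 1) then 1 else 0 := by
  have h : ∀ τ ∈ perms R n, ((R (n + 1) \ Finset.univ.image τ).filter
      fun x => ∃ j, (Fin.snoc τ x : Fin (n + 1) → C) j = c).card =
      if ∃ j, τ j = c then deg R (n + 1) else if c ∈ R (n + 1) then 1 else 0 := by
    intro τ hτ
    rw [← card_sdiff_image_of_mem_perms hds hn hτ]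
    convert card_filter_snoc τ (R (n + 1)) c
  have h' := card_filter_perms_succ R n fun σ => ∃ j, σ j = c
  have h'' := Finset.sum_ite (s := perms R n) (p := fun τ => ∃ j, τ j = c)
    (fun _ => deg R (n + 1)) (fun _ => if c ∈ R (n + 1) then 1 else 0)
  rw [Finset.sum_const, Finset.sum_const, smul_eq_mul, smul_eq_mul] at h''
  rw [← h'', ← Finset.sum_congr rfl h]
  convert h'

theorem stmt3 {C : Type*} [Fintype C] [DecidableEq C]
    (R : ℕ → Finset C) (m : ℕ)
    (hne : ∀ i, 1 ≤ i → i ≤ m → (R i).Nonempty)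
    (hds : DisjointSuperset R m)
    (hdeg : ∀ i, 1 ≤ i → i ≤ m → 1 ≤ deg R i) :
    ∀ i, 1 ≤ i → i ≤ m → ∀ c : C,
      (c ∉ R i → prSpent R i c = prSpent R (i - 1) c) ∧
      (c ∈ R i →
        prSpent R i c = prSpent R (i - 1) c + (1 - prSpent R (i - 1) c) / (deg R i : ℝ)) := by
  intro i hi him c
  obtain ⟨n, rfl⟩ := Nat.exists_eq_add_of_le' hi
  rw [Nat.add_sub_cancel]
  have hN : (numPerms R n : ℝ) ≠ 0 := by
    exact_mod_cast (numPerms_pos hds hdeg n (by omega)).ne'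
  have hd : (deg R (n + 1) : ℝ) ≠ 0 := by
    have := hdeg (n + 1) hi him
    exact_mod_cast (by omega : deg R (n + 1) ≠ 0)
  have hcompl := Finset.card_filter_add_card_filter_not (s := perms R n) fun τ => ∃ j, τ j = c
  have hcount := card_filter_perms_succ_exists hds him c
  change _ = numPerms R n at hcompl
  rw [prSpent, prSpent, numPerms_succ hds him, hcount, ← hcompl]
  rw [← hcompl] at hN
  push_cast at hN ⊢
  constructor
  · intro hc
    rw [if_neg hc]
    field_simp
    simp
  · intro hc
    rw [if_pos hc]
    field_simp
    ring
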